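/- (Summation of the local truncated errors.) Suppose the convergence condition holds, β is twice continuously differentiable, there are constants C₁ ≥ 0, 0 < C₂ ≤ 1/h − 1/t₀, and C₃ > 0 with |β'(t)| ≤ C₁ β(t), |γ'(t) − β''(t)| ≤ C₂ (γ(t) − β'(t)), and β(t) ≤ C₃ w(t) for all t ≥ t₀, and suppose (α/t) β(t) ≤ γ(t) − β'(t) ≤ β(t)/h and β(t) √(‖∇²f(x(t))‖) ≤ √(γ(t) − β'(t)) + √(γ(t) − β'(t) − (α/t) β(t)) for all t ≥ t₀ (operator norm). Then there exists a constant M₃ > 0 such that for every integer n ≥ 0, ∑_{k=0}^{n} t_k^{α} ‖φ(t_k)‖ ≤ M₃ · t_{n+1}^{α − 1/2}. -/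

import Mathlib

open MeasureTheory Set
open scoped RealInnerProductSpace

section helpers
variable {V : Type*} [NormedAddCommGroup V] [InnerProductSpace ℝ V] [CompleteSpace V]

lemma aux_grad_hasFDerivAt {f : V → ℝ} (hf : ContDiff ℝ 2 f) (a : V) :
    HasFDerivAt (gradient f) (fderiv ℝ (gradient f) a) a := by
  have h1 : ContDiff ℝ 1 (fderiv ℝ f) := hf.fderiv_right (by norm_num)
  have h2 : DifferentiableAt ℝ (fderiv ℝ f) a := (h1.differentiable (by norm_num)) a
  have h3 : DifferentiableAt ℝ (gradient f) a := by
    unfold gradient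
    exact ((InnerProductSpace.toDual ℝ V).symm.differentiable _).comp a h2
  exact h3.hasFDerivAt

lemma aux_hess_inner {f : V → ℝ} (hf : ContDiff ℝ 2 f) (a u z : V) :
    ⟪fderiv ℝ (gradient f) a u, z⟫ = fderiv ℝ (fderiv ℝ f) a u z := by
  have h1 : HasFDerivAt (fun y => ⟪gradient f y, z⟫)
      ((innerSL ℝ z).comp (fderiv ℝ (gradient f) a)) a := by
    have := (innerSL ℝ z).hasFDerivAt.comp a (aux_grad_hasFDerivAt hf a)
    refine this.congr_of_eventuallyEq (Filter.Eventually.of_forall fun y => ?_)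
    simp
  have h2 : HasFDerivAt (fun y => fderiv ℝ f y z)
      ((fderiv ℝ (fderiv ℝ f) a).flip z) a := by
    have h1 : ContDiff ℝ 1 (fderiv ℝ f) := hf.fderiv_right (by norm_num)
    have h2 : DifferentiableAt ℝ (fderiv ℝ f) a := (h1.differentiable (by norm_num)) a
    have := h2.hasFDerivAt.clm_apply (hasFDerivAt_const z a)
    simpa using this
  have h3 : (fun y => ⟪gradient f y, z⟫) = fun y => fderiv ℝ f y z := by
    ext y
    simp [gradient]
  rw [h3] at h1
  have := congrArg (fun L => L u) (h1.unique h2)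
  simpa [real_inner_comm] using this

lemma aux_hess_symm {f : V → ℝ} (hf : ContDiff ℝ 2 f) (a u z : V) :
    ⟪fderiv ℝ (gradient f) a u, z⟫ = ⟪fderiv ℝ (gradient f) a z, u⟫ := by
  rw [aux_hess_inner hf, aux_hess_inner hf]
  exact (hf.contDiffAt.isSymmSndFDerivAt (by simp)) u z

lemma aux_line_deriv {f : V → ℝ} (hf : ContDiff ℝ 2 f) (a u : V) (s : ℝ) :
    HasDerivAt (fun s : ℝ => f (a + s • u)) ⟪gradient f (a + s • u), u⟫ s := by
  have h1 : HasDerivAt (fun s : ℝ => a + s • u) u s := by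
    simpa using ((hasDerivAt_id s).smul_const u).const_add a
  have h2 : HasFDerivAt f (fderiv ℝ f (a + s • u)) (a + s • u) :=
    ((hf.differentiable (by norm_num)) _).hasFDerivAt
  have := h2.comp_hasDerivAt s h1
  have e : ⟪gradient f (a + s • u), u⟫ = fderiv ℝ f (a + s • u) u := by simp [gradient]
  rw [e]
  exact this

lemma aux_line_convex {f : V → ℝ} (hc : ConvexOn ℝ univ f) (a u : V) :
    ConvexOn ℝ univ (fun s : ℝ => f (a + s • u)) := by
  refine ⟨convex_univ, fun p _ q _ r t hr ht hrt => ?_⟩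
  have := hc.2 (mem_univ (a + p • u)) (mem_univ (a + q • u)) hr ht hrt
  convert this using 2
  have : t = 1 - r := by linarith
  subst this
  simp only [smul_eq_mul]
  module

lemma aux_first_order {f : V → ℝ} (hf : ContDiff ℝ 2 f) (hc : ConvexOn ℝ univ f) (a b : V) :
    f a - f b ≤ ⟪a - b, gradient f a⟫ := by
  have h := (aux_line_convex hc a (b - a)).le_slope_of_hasDerivAt (mem_univ 0) (mem_univ 1)
    one_pos (aux_line_deriv hf a (b - a) 0)
  simp only [slope_def_field, zero_smul, add_zero, one_smul, sub_zero, div_one,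
    add_sub_cancel] at h
  have e : ⟪a - b, gradient f a⟫ = - ⟪gradient f a, b - a⟫ := by
    rw [real_inner_comm, ← neg_sub b a, inner_neg_right]
  rw [e]; linarith

lemma aux_hess_nonneg {f : V → ℝ} (hf : ContDiff ℝ 2 f) (hc : ConvexOn ℝ univ f) (a u : V) :
    0 ≤ ⟪fderiv ℝ (gradient f) a u, u⟫ := by
  have hm : Monotone (fun s : ℝ => ⟪gradient f (a + s • u), u⟫) := by
    intro p q hpq
    rcases hpq.eq_or_lt with rfl | hlt
    · exact le_rfl
    · exact ((aux_line_convex hc a u).le_slope_of_hasDerivAt (mem_univ p) (mem_univ q) hlt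
        (aux_line_deriv hf a u p)).trans
        ((aux_line_convex hc a u).slope_le_of_hasDerivAt (mem_univ p) (mem_univ q) hlt
        (aux_line_deriv hf a u q))
  have h1 : HasDerivAt (fun s : ℝ => a + s • u) u 0 := by
    simpa using ((hasDerivAt_id (0:ℝ)).smul_const u).const_add a
  have h2 : HasFDerivAt (gradient f) (fderiv ℝ (gradient f) a) (a + (0:ℝ) • u) := by
    simpa using aux_grad_hasFDerivAt hf a
  have h3 := (h2.comp_hasDerivAt (0:ℝ) h1).inner ℝ (hasDerivAt_const (0:ℝ) u)
  have h4 := hm.deriv_nonneg (x := 0)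
  have h5 := h3.deriv
  simp only [Function.comp_def, inner_zero_right, zero_add] at h5
  rw [h5] at h4
  exact h4

lemma aux_hess_sq {f : V → ℝ} (hf : ContDiff ℝ 2 f) (hc : ConvexOn ℝ univ f) (a u : V) :
    ‖fderiv ℝ (gradient f) a u‖ ^ 2
      ≤ ‖fderiv ℝ (gradient f) a‖ * ⟪u, fderiv ℝ (gradient f) a u⟫ := by
  set H := fderiv ℝ (gradient f) a with hH
  rcases (norm_nonneg H).eq_or_lt with h0 | hpos
  · have : H = 0 := norm_eq_zero.mp h0.symm
    simp [this]
  · have h1 := aux_hess_nonneg hf hc a (‖H‖ • u - H u)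
    rw [← hH] at h1
    have h2 : ⟪H (H u), u⟫ = ⟪H u, H u⟫ := aux_hess_symm hf a (H u) u
    have h3 : ⟪H (H u), H u⟫ ≤ ‖H‖ * ‖H u‖ ^ 2 := by
      refine (real_inner_le_norm _ _).trans ?_
      have := H.le_opNorm (H u)
      nlinarith [norm_nonneg (H u)]
    simp only [map_sub, map_smul, inner_sub_left, inner_sub_right, inner_smul_left,
      inner_smul_right, h2, RCLike.conj_to_real, real_inner_self_eq_norm_sq] at h1
    have h5 : ⟪H u, u⟫ = ⟪u, H u⟫ := real_inner_comm _ _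
    try rw [h5] at h1
    have h4 : 0 ≤ ‖H‖ * (‖H‖ * ⟪u, H u⟫ - ‖H u‖ ^ 2) := by nlinarith
    have := nonneg_of_mul_nonneg_right h4 hpos
    linarith

/-- One step of the local error estimate. -/
lemma aux_step {W : Type*} [NormedAddCommGroup W] [NormedSpace ℝ W] {y y' y'' : ℝ → W}
    {E E' D : ℝ → ℝ} {t₀ h K t ε : ℝ} (ht₀ : 0 < t₀) (hh : 0 < h) (ht : t₀ ≤ t) (hε : 0 < ε)
    (hy : ∀ t ∈ Ici t₀, HasDerivWithinAt y (y' t) (Ici t₀) t)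
    (hy' : ∀ t ∈ Ici t₀, HasDerivWithinAt y' (y'' t) (Ici t₀) t)
    (hE : ∀ t ∈ Ici t₀, HasDerivWithinAt E (E' t) (Ici t₀) t)
    (hD0 : ∀ t ∈ Ici t₀, 0 ≤ D t)
    (hED : ∀ t ∈ Ici t₀, E' t ≤ - D t)
    (hK : ∀ t ∈ Ici t₀, t * ‖y'' t‖ ≤ K * √(D t)) :
    t * ‖y (t + h) - y t - h • y' t‖
      ≤ h * (ε * h / 2 + K ^ 2 * (E t - E (t + h)) / (2 * ε)) := by
  have htpos : 0 < t := ht₀.trans_le ht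
  have hsub : Icc t (t + h) ⊆ Ici t₀ := fun s hs => ht.trans hs.1
  have hmem : ∀ s ∈ Ico t (t + h), s ∈ Ici t₀ := fun s hs => ht.trans hs.1
  have hsI : ∀ s ∈ Ico t (t + h), Ici s ⊆ Ici t₀ := fun s hs => Ici_subset_Ici.2 (hmem s hs)
  -- first bound
  have b1 : ∀ s ∈ Icc t (t + h), ‖t • (y' s - y' t)‖
      ≤ ε / 2 * (s - t) + K ^ 2 / (2 * ε) * (E t - E s) := by
    intro s hs
    refine image_norm_le_of_norm_deriv_right_le_deriv_boundary'
      (f := fun s => t • (y' s - y' t)) (f' := fun s => t • y'' s)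
      (B := fun s => ε / 2 * (s - t) + K ^ 2 / (2 * ε) * (E t - E s))
      (B' := fun s => ε / 2 * 1 + K ^ 2 / (2 * ε) * (- E' s)) ?_ ?_ ?_ ?_ ?_ ?_ hs
    · intro s hs
      exact ((((hy' s (hsub hs)).sub_const (y' t)).const_smul t).continuousWithinAt).mono hsub
    · intro s hs
      exact ((((hy' s (hmem s hs)).sub_const (y' t)).const_smul t)).mono (hsI s hs)
    · simp
    · intro s hs
      exact (((((hasDerivWithinAt_id s (Ici t₀)).sub_const t).const_mul (ε / 2)).add
        (((hE s (hsub hs)).const_sub (E t)).const_mul _)).continuousWithinAt).mono hsub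
    · intro s hs
      exact ((((hasDerivWithinAt_id s (Ici t₀)).sub_const t).const_mul (ε / 2)).add
        (((hE s (hmem s hs)).const_sub (E t)).const_mul _)).mono (hsI s hs)
    · intro s hs
      have h1 := hK s (hmem s hs)
      have h2 := hED s (hmem s hs)
      have h3 := Real.sq_sqrt (hD0 s (hmem s hs))
      rw [norm_smul, Real.norm_of_nonneg htpos.le]
      have h4 : t * ‖y'' s‖ ≤ s * ‖y'' s‖ := mul_le_mul_of_nonneg_right hs.1 (norm_nonneg _)
      have h5 : K * √(D s) ≤ ε / 2 * 1 + K ^ 2 / (2 * ε) * (√(D s)) ^ 2 := by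
        have : ε / 2 * 1 + K ^ 2 / (2 * ε) * (√(D s)) ^ 2 - K * √(D s)
            = (ε - K * √(D s)) ^ 2 / (2 * ε) := by
          field_simp; ring
        have h6 : 0 ≤ (ε - K * √(D s)) ^ 2 / (2 * ε) := by positivity
        linarith
      rw [h3] at h5
      have h7 : K ^ 2 / (2 * ε) * D s ≤ K ^ 2 / (2 * ε) * (- E' s) :=
        mul_le_mul_of_nonneg_left (by linarith) (by positivity)
      linarith
  have hanti : AntitoneOn E (Icc t (t + h)) := by
    refine antitoneOn_of_hasDerivWithinAt_nonpos (f' := E') (convex_Icc _ _) (fun s hs =>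
      ((hE s (hsub hs)).continuousWithinAt).mono hsub) (fun s hs => ?_) (fun s hs => ?_)
    · exact (hE s (hsub (interior_subset hs))).mono (interior_subset.trans hsub)
    · have := hED s (hsub (interior_subset hs))
      have := hD0 s (hsub (interior_subset hs))
      linarith
  set C := ε * h / 2 + K ^ 2 * (E t - E (t + h)) / (2 * ε) with hC
  have b2 : ∀ s ∈ Icc t (t + h), ‖t • (y' s - y' t)‖ ≤ C := by
    intro s hs
    refine (b1 s hs).trans ?_
    have h1 := hanti hs (right_mem_Icc.2 (by linarith)) hs.2
    have h2 : K ^ 2 / (2 * ε) * (E t - E s) ≤ K ^ 2 / (2 * ε) * (E t - E (t + h)) :=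
      mul_le_mul_of_nonneg_left (by linarith) (by positivity)
    have h3 : ε / 2 * (s - t) ≤ ε / 2 * h :=
      mul_le_mul_of_nonneg_left (by linarith [hs.2]) (by positivity)
    have h4 : C = ε / 2 * h + K ^ 2 / (2 * ε) * (E t - E (t + h)) := by rw [hC]; ring
    linarith
  have b3 := image_norm_le_of_norm_deriv_right_le_deriv_boundary'
      (f := fun s => t • (y s - y t - (s - t) • y' t)) (f' := fun s => t • (y' s - (1:ℝ) • y' t))
      (B := fun s => C * (s - t))
      (B' := fun s => C * 1) (a := t) (b := t + h) ?_ ?_ ?_ ?_ ?_ ?_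
      (right_mem_Icc.2 (by linarith))
  · simp only [add_sub_cancel_left] at b3
    rw [norm_smul, Real.norm_of_nonneg htpos.le] at b3
    linarith
  · intro s hs
    exact ((((hy s (hsub hs)).sub_const (y t)).sub
      (((hasDerivWithinAt_id s (Ici t₀)).sub_const t).smul_const (y' t))).const_smul t
      ).continuousWithinAt.mono hsub
  · intro s hs
    exact ((((hy s (hmem s hs)).sub_const (y t)).sub
      (((hasDerivWithinAt_id s (Ici t₀)).sub_const t).smul_const (y' t))).const_smul t
      ).mono (hsI s hs)
  · simp
  · fun_prop
  · intro s hs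
    exact ((hasDerivWithinAt_id s (Ici s)).sub_const t).const_mul C
  · intro s hs
    have := b2 s ⟨hs.1, hs.2.le⟩
    simpa using this

/-- Algebra of the energy derivative. -/
lemma aux_alg (X p g G : V) (t α κ lam b b' c dl F : ℝ) (ht : 0 < t) (x2 v v1 : V) (dt w : ℝ)
    (hx2 : x2 = - (α / t) • p - b • G - c • g)
    (hv : v = p + b • g)
    (hv1 : v1 = - (α / t) • p + (b' - c) • g)
    (hdt : dt = t ^ 2 * (c - κ * b' - κ * b / t) + (κ * (α - 1 - lam) - lam * (1 - κ)) * t * b)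
    (hw : w = c - b' - b / t) :
    dl * F + dt * ⟪g, p⟫
      + (1 - κ) * lam * ((1 * b + t * b') * ⟪X, g⟫ + t * b * (⟪X, G⟫ + ⟪p, g⟫))
      + (1 - κ) * ⟪lam • X + t • p, lam • p + (t • x2 + (1:ℝ) • p)⟫
      + κ * ⟪lam • X + t • v, lam • p + (t • v1 + (1:ℝ) • v)⟫
      + lam * (α - 1 - lam) * ⟪X, p⟫
    = dl * F - lam * t * w * ⟪X, g⟫ - ((α - 1 - lam) * t * ‖p‖ ^ 2
        + (1 - κ) * t ^ 2 * b * ⟪p, G⟫ + κ * t ^ 2 * b * w * ‖g‖ ^ 2) := by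
  subst hx2 hv hv1 hdt hw
  rw [← real_inner_self_eq_norm_sq, ← real_inner_self_eq_norm_sq]
  simp only [inner_add_left, inner_add_right, inner_sub_right, inner_smul_left,
    inner_smul_right, RCLike.conj_to_real, real_inner_comm p g]
  field_simp
  ring

end helpers

lemma aux_le_sqrt {a L D : ℝ} (hL : 0 ≤ L) (h : a ^ 2 ≤ L * D) : a ≤ √L * √D := by
  rw [← Real.sqrt_mul hL]
  exact Real.le_sqrt_of_sq_le h

lemma aux_sqrt_add {a b : ℝ} (ha : 0 ≤ a) (hb : 0 ≤ b) : √(a ^ 2 + b ^ 2) ≤ a + b := by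
  refine Real.sqrt_le_iff.2 ⟨by positivity, ?_⟩
  nlinarith [mul_nonneg ha hb]

set_option maxHeartbeats 2000000 in
theorem stmt_5
    {d : ℕ} (f : EuclideanSpace ℝ (Fin d) → ℝ)
    (hf : ContDiff ℝ 2 f) (hconv : ConvexOn ℝ univ f)
    (xstar : EuclideanSpace ℝ (Fin d)) (fstar : ℝ)
    (hmin : ∀ y, f xstar ≤ f y) (hfstar : fstar = f xstar)
    (t₀ α h κ lam : ℝ) (ht₀ : 0 < t₀) (hα : 1 < α) (hh : 0 < h) (hht₀ : h < t₀)
    (hκ : κ ∈ Ioo (0:ℝ) 1) (hlam : lam ∈ Ioo (0:ℝ) (α - 1))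
    (β β' β'' γ γ' : ℝ → ℝ)
    (hβnn : ∀ t ∈ Ici t₀, 0 ≤ β t) (hγnn : ∀ t ∈ Ici t₀, 0 ≤ γ t)
    (hβd : ∀ t ∈ Ici t₀, HasDerivWithinAt β (β' t) (Ici t₀) t)
    (hβ'd : ∀ t ∈ Ici t₀, HasDerivWithinAt β' (β'' t) (Ici t₀) t)
    (hβ''c : ContinuousOn β'' (Ici t₀))
    (hγd : ∀ t ∈ Ici t₀, HasDerivWithinAt γ (γ' t) (Ici t₀) t)
    (hγ'c : ContinuousOn γ' (Ici t₀))
    (δ w : ℝ → ℝ)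
    (hδ : ∀ t, δ t = t^2 * (γ t - κ * β' t - κ * β t / t)
        + (κ * (α - 1 - lam) - lam * (1 - κ)) * t * β t)
    (hw : ∀ t, w t = γ t - β' t - β t / t)
    (δ' : ℝ → ℝ)
    (hδ'd : ∀ t ∈ Ici t₀, HasDerivWithinAt δ (δ' t) (Ici t₀) t)
    (hconvergence : ∀ t ∈ Ici t₀, 0 < δ t ∧ δ' t ≤ lam * t * w t)
    (x x' x'' : ℝ → EuclideanSpace ℝ (Fin d))
    (hxd : ∀ t ∈ Ici t₀, HasDerivWithinAt x (x' t) (Ici t₀) t)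
    (hx'd : ∀ t ∈ Ici t₀, HasDerivWithinAt x' (x'' t) (Ici t₀) t)
    (hx''c : ContinuousOn x'' (Ici t₀))
    (hISHD : ∀ t ∈ Ici t₀,
      x'' t + (α / t) • x' t + β t • (fderiv ℝ (gradient f) (x t)) (x' t)
        + γ t • gradient f (x t) = 0)
    (v : ℝ → EuclideanSpace ℝ (Fin d))
    (hv : ∀ t, v t = x' t + β t • gradient f (x t))
    (C₁ C₂ C₃ : ℝ) (hC₁ : 0 ≤ C₁) (hC₂0 : 0 < C₂) (hC₂ : C₂ ≤ 1 / h - 1 / t₀)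
    (hC₃ : 0 < C₃)
    (hgrowth₁ : ∀ t ∈ Ici t₀, |β' t| ≤ C₁ * β t)
    (hgrowth₂ : ∀ t ∈ Ici t₀, |γ' t - β'' t| ≤ C₂ * (γ t - β' t))
    (hgrowth₃ : ∀ t ∈ Ici t₀, β t ≤ C₃ * w t)
    (hstab₁ : ∀ t ∈ Ici t₀, (α / t) * β t ≤ γ t - β' t ∧ γ t - β' t ≤ β t / h)
    (hstab₂ : ∀ t ∈ Ici t₀,
      β t * Real.sqrt ‖fderiv ℝ (gradient f) (x t)‖
        ≤ Real.sqrt (γ t - β' t) + Real.sqrt (γ t - β' t - (α / t) * β t))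
    (φx φv : ℝ → EuclideanSpace ℝ (Fin d))
    (hφx : ∀ t, φx t = x (t + h) - x t - h • (v t - β t • gradient f (x t)))
    (hφv : ∀ t, φv t = v (t + h) - v t
        - h • (-(α / t) • v t + ((α / t) * β t + β' t - γ t) • gradient f (x t))) :
    ∃ M₃ : ℝ, 0 < M₃ ∧ ∀ N : ℕ,
      (∑ k ∈ Finset.range (N + 1),
          (t₀ + k * h) ^ α * Real.sqrt (‖φx (t₀ + k * h)‖ ^ 2 + ‖φv (t₀ + k * h)‖ ^ 2))
        ≤ M₃ * (t₀ + (N + 1) * h) ^ (α - 1 / 2) := by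
  obtain ⟨hκ0, hκ1⟩ := hκ
  obtain ⟨hl0, hl1⟩ := hlam
  have hκ1' : 0 < 1 - κ := by linarith
  have hl1' : 0 < α - 1 - lam := by linarith
  have hα0 : 0 < α := by linarith
  have hpos : ∀ t ∈ Ici t₀, 0 < t := fun t ht => lt_of_lt_of_le ht₀ ht
  let g : ℝ → EuclideanSpace ℝ (Fin d) := fun t => gradient f (x t)
  let G : ℝ → EuclideanSpace ℝ (Fin d) := fun t => fderiv ℝ (gradient f) (x t) (x' t)
  have hgd : ∀ t ∈ Ici t₀, HasDerivWithinAt g (G t) (Ici t₀) t := fun t ht =>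
    (aux_grad_hasFDerivAt hf (x t)).comp_hasDerivWithinAt t (hxd t ht)
  have hFd : ∀ t ∈ Ici t₀, HasDerivWithinAt (fun t => f (x t)) ⟪g t, x' t⟫ (Ici t₀) t := by
    intro t ht
    have h1 : HasFDerivAt f (fderiv ℝ f (x t)) (x t) :=
      ((hf.differentiable (by norm_num)) _).hasFDerivAt
    have h2 := h1.comp_hasDerivWithinAt t (hxd t ht)
    have e : ⟪g t, x' t⟫ = fderiv ℝ f (x t) (x' t) := by simp [g, gradient]
    rw [e]
    exact h2
  have hx2 : ∀ t ∈ Ici t₀, x'' t = - (α / t) • x' t - β t • G t - γ t • g t := by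
    intro t ht
    have := hISHD t ht
    have h2 : x'' t = (x'' t + (α / t) • x' t + β t • G t + γ t • g t)
        + (- (α / t) • x' t - β t • G t - γ t • g t) := by module
    rw [h2]
    have h3 : x'' t + (α / t) • x' t + β t • G t + γ t • g t = 0 := this
    rw [h3, zero_add]
  -- derivatives of `v`
  let v1 : ℝ → EuclideanSpace ℝ (Fin d) := fun t => - (α / t) • x' t + (β' t - γ t) • g t
  let v2 : ℝ → EuclideanSpace ℝ (Fin d) := fun t =>
    (α / t ^ 2) • x' t - (α / t) • x'' t + (β'' t - γ' t) • g t + (β' t - γ t) • G t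
  have hvd : ∀ t ∈ Ici t₀, HasDerivWithinAt v (v1 t) (Ici t₀) t := by
    intro t ht
    have h1 := (hx'd t ht).add ((hβd t ht).smul (hgd t ht))
    have h2 : v = fun t => x' t + β t • g t := funext hv
    rw [h2]
    refine HasDerivWithinAt.congr_deriv h1 ?_
    rw [hx2 t ht]
    simp only [v1]
    module
  have hv1d : ∀ t ∈ Ici t₀, HasDerivWithinAt v1 (v2 t) (Ici t₀) t := by
    intro t ht
    have htp := hpos t ht
    have h0 : HasDerivWithinAt (fun t : ℝ => - (α / t)) (α / t ^ 2) (Ici t₀) t := by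
      have := ((hasDerivAt_inv htp.ne').const_mul α).neg.hasDerivWithinAt (s := Ici t₀)
      refine (this.congr_deriv (by field_simp)).congr_of_eventuallyEq ?_ ?_
      · exact Filter.Eventually.of_forall fun s => by simp [div_eq_mul_inv]
      · simp [div_eq_mul_inv]
    have h1 := (h0.smul (hx'd t ht)).add (((hβ'd t ht).sub (hγd t ht)).smul (hgd t ht))
    refine HasDerivWithinAt.congr_deriv h1 ?_
    simp only [v2, Pi.sub_apply]
    module
  -- the dissipation
  let D : ℝ → ℝ := fun t => (α - 1 - lam) * t * ‖x' t‖ ^ 2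
        + (1 - κ) * t ^ 2 * β t * ⟪x' t, G t⟫ + κ * t ^ 2 * β t * w t * ‖g t‖ ^ 2
  have hGnn : ∀ t, 0 ≤ ⟪x' t, G t⟫ := fun t => by
    rw [real_inner_comm]; exact aux_hess_nonneg hf hconv (x t) (x' t)
  have hwnn : ∀ t ∈ Ici t₀, 0 ≤ w t := fun t ht => by
    have h1 := hgrowth₃ t ht
    have h2 := hβnn t ht
    exact nonneg_of_mul_nonneg_right (h2.trans h1) hC₃
  have hT1 : ∀ t ∈ Ici t₀, 0 ≤ (α - 1 - lam) * t * ‖x' t‖ ^ 2 := fun t ht => by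
    have := hpos t ht
    positivity
  have hT2 : ∀ t ∈ Ici t₀, 0 ≤ (1 - κ) * t ^ 2 * β t * ⟪x' t, G t⟫ := fun t ht => by
    have := hpos t ht
    have := hβnn t ht
    have := hGnn t
    positivity
  have hT3 : ∀ t ∈ Ici t₀, 0 ≤ κ * t ^ 2 * β t * w t * ‖g t‖ ^ 2 := fun t ht => by
    have := hpos t ht
    have := hβnn t ht
    have := hwnn t ht
    positivity
  have hD0 : ∀ t ∈ Ici t₀, 0 ≤ D t := fun t ht => by
    have := hT1 t ht
    have := hT2 t ht
    have := hT3 t ht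
    simp only [D]
    linarith
  -- the energy
  let E : ℝ → ℝ := fun t => δ t * (f (x t) - fstar)
    + (1 - κ) * lam * (t * β t * ⟪x t - xstar, g t⟫)
    + (1 - κ) * (1 / 2 * ‖lam • (x t - xstar) + t • x' t‖ ^ 2)
    + κ * (1 / 2 * ‖lam • (x t - xstar) + t • v t‖ ^ 2)
    + lam * (α - 1 - lam) * (1 / 2 * ‖x t - xstar‖ ^ 2)
  let E' : ℝ → ℝ := fun t => δ' t * (f (x t) - fstar)
    - lam * t * w t * ⟪x t - xstar, g t⟫ - D t
  have hEd : ∀ t ∈ Ici t₀, HasDerivWithinAt E (E' t) (Ici t₀) t := by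
    intro t ht
    have hX := (hxd t ht).sub_const xstar
    have hid := hasDerivWithinAt_id t (Ici t₀)
    have a1 := (hδ'd t ht).mul ((hFd t ht).sub_const fstar)
    have a2 := ((hid.mul (hβd t ht)).mul (hX.inner ℝ (hgd t ht))).const_mul ((1 - κ) * lam)
    have a3 := ((((hX.const_smul lam).add (hid.smul (hx'd t ht))).norm_sq).const_mul
      (1 / 2)).const_mul (1 - κ)
    have a4 := ((((hX.const_smul lam).add (hid.smul (hvd t ht))).norm_sq).const_mul
      (1 / 2)).const_mul κ
    have a5 := ((hX.norm_sq).const_mul (1 / 2)).const_mul (lam * (α - 1 - lam))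
    have := (((a1.add a2).add a3).add a4).add a5
    refine HasDerivWithinAt.congr_deriv this ?_
    have key := aux_alg (x t - xstar) (x' t) (g t) (G t) t α κ lam (β t) (β' t) (γ t) (δ' t)
      (f (x t) - fstar) (hpos t ht) (x'' t) (v t) (v1 t) (δ t) (w t) (hx2 t ht) (hv t) rfl
      (hδ t) (hw t)
    simp only [E', D, ← key]
    simp only [id, Pi.mul_apply, Pi.add_apply, Pi.smul_apply, Pi.smul_apply']
    ring
  have hXg : ∀ t, f (x t) - fstar ≤ ⟪x t - xstar, g t⟫ := fun t => by
    rw [hfstar]; exact aux_first_order hf hconv (x t) xstar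
  have hFnn : ∀ t, 0 ≤ f (x t) - fstar := fun t => by
    rw [hfstar]; linarith [hmin (x t)]
  have hED : ∀ t ∈ Ici t₀, E' t ≤ - D t := by
    intro t ht
    have h1 := (hconvergence t ht).2
    have h2 : 0 ≤ lam * t * w t := by
      have := hpos t ht
      have := hwnn t ht
      positivity
    have h3 := mul_le_mul_of_nonneg_right h1 (hFnn t)
    have h4 := mul_le_mul_of_nonneg_left (hXg t) h2
    simp only [E']
    linarith
  have hE0 : ∀ t ∈ Ici t₀, 0 ≤ E t := by
    intro t ht
    have h1 := (hconvergence t ht).1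
    have h2 := hFnn t
    have h3 := h2.trans (hXg t)
    have h4 := hpos t ht
    have h5 := hβnn t ht
    simp only [E]
    positivity
  -- bounds by the dissipation
  have hDle1 : ∀ t ∈ Ici t₀, (α - 1 - lam) * t * ‖x' t‖ ^ 2 ≤ D t := fun t ht => by
    simp only [D]; linarith [hT2 t ht, hT3 t ht]
  have hDle2 : ∀ t ∈ Ici t₀, (1 - κ) * t ^ 2 * β t * ⟪x' t, G t⟫ ≤ D t := fun t ht => by
    simp only [D]; linarith [hT1 t ht, hT3 t ht]
  have hDle3 : ∀ t ∈ Ici t₀, κ * t ^ 2 * β t * w t * ‖g t‖ ^ 2 ≤ D t := fun t ht => by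
    simp only [D]; linarith [hT1 t ht, hT2 t ht]
  obtain ⟨Kp, hKp0, hKp⟩ : ∃ K : ℝ, 0 ≤ K ∧ ∀ t ∈ Ici t₀, ‖x' t‖ ≤ K * √(D t) := by
    refine ⟨√(1 / ((α - 1 - lam) * t₀)), Real.sqrt_nonneg _, fun t ht => ?_⟩
    refine aux_le_sqrt (by positivity) ?_
    have h1 := hDle1 t ht
    have h2 : (α - 1 - lam) * t₀ * ‖x' t‖ ^ 2 ≤ (α - 1 - lam) * t * ‖x' t‖ ^ 2 := by
      have : t₀ ≤ t := ht
      gcongr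
    rw [one_div, inv_mul_eq_div, le_div_iff₀ (by positivity)]
    linarith
  obtain ⟨KG, hKG0, hKG⟩ : ∃ K : ℝ, 0 ≤ K ∧ ∀ t ∈ Ici t₀, t * (β t * ‖G t‖) ≤ K * √(D t) := by
    refine ⟨√(4 / (h * (1 - κ))), Real.sqrt_nonneg _, fun t ht => ?_⟩
    refine aux_le_sqrt (by positivity) ?_
    have htp := hpos t ht
    have hb := hβnn t ht
    have h1 := hDle2 t ht
    have h2 := hstab₂ t ht
    obtain ⟨h3, h4⟩ := hstab₁ t ht
    have h5 : 0 ≤ (α / t) * β t := by positivity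
    have h6 : √(γ t - β' t - (α / t) * β t) ≤ √(γ t - β' t) := Real.sqrt_le_sqrt (by linarith)
    have h7 : (β t * √‖fderiv ℝ (gradient f) (x t)‖) ^ 2 ≤ (2 * √(γ t - β' t)) ^ 2 := by
      have : β t * √‖fderiv ℝ (gradient f) (x t)‖ ≤ 2 * √(γ t - β' t) := by linarith
      gcongr
    rw [mul_pow, mul_pow, Real.sq_sqrt (norm_nonneg _), Real.sq_sqrt (by linarith)] at h7
    have h8 : β t ^ 2 * ‖fderiv ℝ (gradient f) (x t)‖ ≤ 4 * (β t / h) := by linarith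
    have h9 := aux_hess_sq hf hconv (x t) (x' t)
    have h10 : β t ^ 2 * ‖G t‖ ^ 2 ≤ 4 * (β t / h) * ⟪x' t, G t⟫ := by
      calc β t ^ 2 * ‖G t‖ ^ 2
          ≤ β t ^ 2 * (‖fderiv ℝ (gradient f) (x t)‖ * ⟪x' t, G t⟫) := 
            mul_le_mul_of_nonneg_left h9 (by positivity)
        _ = (β t ^ 2 * ‖fderiv ℝ (gradient f) (x t)‖) * ⟪x' t, G t⟫ := by ring
        _ ≤ _ := mul_le_mul_of_nonneg_right h8 (hGnn t)
    calc (t * (β t * ‖G t‖)) ^ 2 = t ^ 2 * (β t ^ 2 * ‖G t‖ ^ 2) := by ring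
      _ ≤ t ^ 2 * (4 * (β t / h) * ⟪x' t, G t⟫) := by gcongr
      _ = 4 / (h * (1 - κ)) * ((1 - κ) * t ^ 2 * β t * ⟪x' t, G t⟫) := by field_simp
      _ ≤ _ := by gcongr
  obtain ⟨Kg, hKg0, hKg⟩ : ∃ K : ℝ, 0 ≤ K ∧ ∀ t ∈ Ici t₀, t * (β t * ‖g t‖) ≤ K * √(D t) := by
    refine ⟨√(C₃ / κ), Real.sqrt_nonneg _, fun t ht => ?_⟩
    refine aux_le_sqrt (by positivity) ?_
    have htp := hpos t ht
    have hb := hβnn t ht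
    have h1 := hDle3 t ht
    have h2 := hgrowth₃ t ht
    calc (t * (β t * ‖g t‖)) ^ 2 = t ^ 2 * β t * β t * ‖g t‖ ^ 2 := by ring
      _ ≤ t ^ 2 * β t * (C₃ * w t) * ‖g t‖ ^ 2 := by gcongr
      _ = C₃ / κ * (κ * t ^ 2 * β t * w t * ‖g t‖ ^ 2) := by field_simp
      _ ≤ _ := by gcongr
  obtain ⟨Kx, hKx0, hKx⟩ : ∃ K : ℝ, 0 ≤ K ∧ ∀ t ∈ Ici t₀, t * ‖x'' t‖ ≤ K * √(D t) := by
    refine ⟨α * Kp + KG + (C₁ + 1 / h) * Kg, by positivity, fun t ht => ?_⟩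
    have htp := hpos t ht
    have hb := hβnn t ht
    have hc := hγnn t ht
    have h1 : ‖x'' t‖ ≤ α / t * ‖x' t‖ + β t * ‖G t‖ + γ t * ‖g t‖ := by
      rw [hx2 t ht]
      refine (norm_sub_le _ _).trans (add_le_add ((norm_sub_le _ _).trans ?_) ?_)
      · rw [norm_smul, norm_smul, norm_neg, Real.norm_of_nonneg hb,
          Real.norm_of_nonneg (by positivity)]
      · rw [norm_smul, Real.norm_of_nonneg hc]
    have h2 : γ t ≤ (C₁ + 1 / h) * β t := by
      have h3 := (hstab₁ t ht).2
      have h4 := (le_abs_self _).trans (hgrowth₁ t ht)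
      have : (C₁ + 1 / h) * β t = C₁ * β t + β t / h := by ring
      linarith
    calc t * ‖x'' t‖ ≤ t * (α / t * ‖x' t‖ + β t * ‖G t‖ + γ t * ‖g t‖) := by gcongr
      _ ≤ t * (α / t * ‖x' t‖ + β t * ‖G t‖ + (C₁ + 1 / h) * β t * ‖g t‖) := by gcongr
      _ = α * ‖x' t‖ + t * (β t * ‖G t‖) + (C₁ + 1 / h) * (t * (β t * ‖g t‖)) := by
        field_simp
      _ ≤ α * (Kp * √(D t)) + KG * √(D t) + (C₁ + 1 / h) * (Kg * √(D t)) := by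
        exact add_le_add (add_le_add (mul_le_mul_of_nonneg_left (hKp t ht) hα0.le) (hKG t ht))
          (mul_le_mul_of_nonneg_left (hKg t ht) (by positivity))
      _ = _ := by ring
  obtain ⟨Kv, hKv0, hKv⟩ : ∃ K : ℝ, 0 ≤ K ∧ ∀ t ∈ Ici t₀, t * ‖v2 t‖ ≤ K * √(D t) := by
    refine ⟨α / t₀ * Kp + α / t₀ * Kx + C₂ / h * Kg + 1 / h * KG, by positivity,
      fun t ht => ?_⟩
    have htp := hpos t ht
    have hb := hβnn t ht
    have ht' : t₀ ≤ t := ht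
    obtain ⟨hs1, hs2⟩ := hstab₁ t ht
    have hs0 : 0 ≤ (α / t) * β t := by positivity
    have hg2 := hgrowth₂ t ht
    have h1 : ‖v2 t‖ ≤ α / t ^ 2 * ‖x' t‖ + α / t * ‖x'' t‖ + C₂ * (β t / h) * ‖g t‖
        + β t / h * ‖G t‖ := by
      simp only [v2]
      refine (norm_add_le _ _).trans (add_le_add ((norm_add_le _ _).trans (add_le_add
        ((norm_sub_le _ _).trans ?_) ?_)) ?_)
      · rw [norm_smul, norm_smul, Real.norm_of_nonneg (show 0 ≤ α / t ^ 2 by positivity),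
          Real.norm_of_nonneg (show 0 ≤ α / t by positivity)]
      · rw [norm_smul, Real.norm_eq_abs, abs_sub_comm]
        gcongr
        exact hg2.trans (by gcongr)
      · rw [norm_smul, Real.norm_eq_abs, abs_sub_comm, abs_of_nonneg (by linarith)]
        gcongr
    have hq : α / t ≤ α / t₀ := by gcongr
    calc t * ‖v2 t‖ ≤ t * (α / t ^ 2 * ‖x' t‖ + α / t * ‖x'' t‖ + C₂ * (β t / h) * ‖g t‖
        + β t / h * ‖G t‖) := by gcongr
      _ = α / t * ‖x' t‖ + α / t * (t * ‖x'' t‖) + C₂ / h * (t * (β t * ‖g t‖))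
        + 1 / h * (t * (β t * ‖G t‖)) := by field_simp
      _ ≤ α / t₀ * (Kp * √(D t)) + α / t₀ * (Kx * √(D t)) + C₂ / h * (Kg * √(D t))
        + 1 / h * (KG * √(D t)) := by
        refine add_le_add (add_le_add (add_le_add ?_ ?_) ?_) ?_
        · exact mul_le_mul hq (hKp t ht) (norm_nonneg _) (by positivity)
        · exact mul_le_mul hq (hKx t ht) (by positivity) (by positivity)
        · exact mul_le_mul_of_nonneg_left (hKg t ht) (by positivity)
        · exact mul_le_mul_of_nonneg_left (hKG t ht) (by positivity)
      _ = _ := by ring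
  -- one step
  have hstep : ∀ t ∈ Ici t₀, ∀ ε > 0, t * √(‖φx t‖ ^ 2 + ‖φv t‖ ^ 2)
      ≤ h * (ε * h + (Kx ^ 2 + Kv ^ 2) * (E t - E (t + h)) / (2 * ε)) := by
    intro t ht ε hε
    have htp := hpos t ht
    have s1 := aux_step ht₀ hh ht hε hxd hx'd hEd hD0 hED hKx
    have s2 := aux_step ht₀ hh ht hε hvd hv1d hEd hD0 hED hKv
    have e1 : φx t = x (t + h) - x t - h • x' t := by
      rw [hφx, hv]; simp
    have e2 : φv t = v (t + h) - v t - h • v1 t := by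
      rw [hφv]
      congr 2
      rw [hv t]
      simp only [v1, g]
      module
    rw [← e1] at s1
    rw [← e2] at s2
    have h1 : √(‖φx t‖ ^ 2 + ‖φv t‖ ^ 2) ≤ ‖φx t‖ + ‖φv t‖ := by
      exact aux_sqrt_add (norm_nonneg _) (norm_nonneg _)
    calc t * √(‖φx t‖ ^ 2 + ‖φv t‖ ^ 2) ≤ t * (‖φx t‖ + ‖φv t‖) := by gcongr
      _ = t * ‖φx t‖ + t * ‖φv t‖ := by ring
      _ ≤ _ := add_le_add s1 s2
      _ = _ := by ring
  -- summation
  set K := Kx ^ 2 + Kv ^ 2 with hK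
  have hKnn : 0 ≤ K := by positivity
  have hE00 := hE0 t₀ self_mem_Ici
  refine ⟨h * (1 + K * E t₀ / 2), by positivity, fun N => ?_⟩
  set T := t₀ + (N + 1) * h with hT
  have hTpos : 0 < T := by positivity
  have hterm : ∀ k ∈ Finset.range (N + 1),
      (t₀ + k * h) ^ α * √(‖φx (t₀ + k * h)‖ ^ 2 + ‖φv (t₀ + k * h)‖ ^ 2)
      ≤ T ^ (α - 1) * (h * (T ^ (-(1 / 2 : ℝ)) * h
        + K * (E (t₀ + k * h) - E (t₀ + (k + 1 : ℕ) * h)) / (2 * T ^ (-(1 / 2 : ℝ))))) := by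
    intro k hk
    have hkN : (k : ℝ) ≤ N + 1 := by
      have : k < N + 1 := Finset.mem_range.1 hk
      exact_mod_cast this.le
    have htk : t₀ + k * h ∈ Ici t₀ := by
      have : 0 ≤ (k : ℝ) * h := by positivity
      simp only [mem_Ici]; linarith
    have htkp := hpos _ htk
    have htkT : t₀ + k * h ≤ T := by rw [hT]; gcongr
    have hs := hstep _ htk (T ^ (-(1 / 2 : ℝ))) (by positivity)
    have e : t₀ + k * h + h = t₀ + (k + 1 : ℕ) * h := by push_cast; ring
    rw [e] at hs
    have e2 : (t₀ + k * h) ^ α = (t₀ + k * h) ^ (α - 1) * (t₀ + k * h) := by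
      rw [← Real.rpow_add_one htkp.ne']; congr 1; ring
    rw [e2, mul_assoc]
    exact mul_le_mul (Real.rpow_le_rpow htkp.le htkT (by linarith)) hs (by positivity)
      (by positivity)
  refine (Finset.sum_le_sum hterm).trans ?_
  rw [← Finset.mul_sum, ← Finset.mul_sum, Finset.sum_add_distrib, ← Finset.sum_div,
    ← Finset.mul_sum, ← Finset.mul_sum, Finset.sum_range_sub' (fun k : ℕ => E (t₀ + k * h))]
  simp only [Finset.sum_const, Finset.card_range, nsmul_eq_mul, Nat.cast_zero, zero_mul, add_zero]
  have hEN : 0 ≤ E (t₀ + (N + 1 : ℕ) * h) := by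
    refine hE0 _ ?_
    have : 0 ≤ ((N + 1 : ℕ) : ℝ) * h := by positivity
    simp only [mem_Ici]; linarith
  have p1 : T ^ (α - 1) * (T ^ (-(1 / 2 : ℝ)) * T) = T ^ (α - 1 / 2) := by
    rw [← Real.rpow_add_one hTpos.ne', ← Real.rpow_add hTpos]; congr 1; ring
  have p2 : T ^ (α - 1) / T ^ (-(1 / 2 : ℝ)) = T ^ (α - 1 / 2) := by
    rw [← Real.rpow_sub hTpos]; congr 1; ring
  have hNT : ((N + 1 : ℕ) : ℝ) * h ≤ T := by
    rw [hT]; push_cast; linarith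
  calc _ ≤ T ^ (α - 1) * (h * (T ^ (-(1 / 2 : ℝ)) * T
        + K * E t₀ / (2 * T ^ (-(1 / 2 : ℝ))))) := by
        gcongr T ^ (α - 1) * (h * (?_ + K * ?_ / _))
        · exact mul_le_mul_of_nonneg_left hNT (by positivity)
        · linarith
    _ = h * (T ^ (α - 1) * (T ^ (-(1 / 2 : ℝ)) * T))
        + h * (K * E t₀ / 2) * (T ^ (α - 1) / T ^ (-(1 / 2 : ℝ))) := by
        field_simp
    _ = _ := by rw [p1, p2]; ring
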